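/- Let n ≥ 1 and let M = e^{-V} be a positive C² function on ℝⁿ with M ∈ L¹(ℝⁿ). Assume that M satisfies the classical Poincaré inequality, i.e. there is λ(M) > 0 such that ∫_{ℝⁿ} |∇f|² M dx ≥ λ(M) ∫_{ℝⁿ} |f - ∫_{ℝⁿ} f M dx|² M dy for all f ∈ H¹(ℝⁿ,M), and that there exists ε > 0 such that (1-ε)|∇V(x)|²/2 - ΔV(x) → +∞ as |x| → ∞. Then there exists λ'(M) > 0 such that for every f ∈ H¹(ℝⁿ,M) with ∫_{ℝⁿ} f(x) M(x) dx = 0, one has ∫_{ℝⁿ} |∇f(x)|² M(x) dx ≥ λ'(M) ∫_{ℝⁿ} |f(x)|² (1 + |∇ ln M(x)|²) M(x) dx. -/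

import Mathlib

open MeasureTheory Filter Real Set

/-- The Laplacian of a function on `EuclideanSpace ℝ (Fin n)`, defined as the sum of the
second derivatives in the coordinate directions. -/
noncomputable def laplacian {n : ℕ} (V : EuclideanSpace ℝ (Fin n) → ℝ)
    (x : EuclideanSpace ℝ (Fin n)) : ℝ :=
  ∑ i : Fin n, fderiv ℝ (fun y => fderiv ℝ V y (EuclideanSpace.single i 1)) x
    (EuclideanSpace.single i 1)

/-- Membership in the weighted Sobolev space `H¹(ℝⁿ, M)`: `f` is differentiable and both
`f` and its gradient are square integrable against the measure `M(x) dx`. -/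
def MemH1 {n : ℕ} (M f : EuclideanSpace ℝ (Fin n) → ℝ) : Prop :=
  Differentiable ℝ f ∧ Integrable (fun x => f x ^ 2 * M x) ∧
    Integrable (fun x => ‖gradient f x‖ ^ 2 * M x)


/-- Integration by parts in one direction. -/
lemma ibp_dir {n : ℕ} (V M f χ : EuclideanSpace ℝ (Fin n) → ℝ)
    (hV : ContDiff ℝ 2 V) (hM : ∀ x, M x = Real.exp (-V x)) (hMint : Integrable M)
    (hf : MemH1 M f) (hχ : ContDiff ℝ 1 χ) (hχc : HasCompactSupport χ)
    (v : EuclideanSpace ℝ (Fin n)) :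
    Integrable (fun x => (χ x ^ 2 * f x ^ 2) * ((fderiv ℝ (fun y => fderiv ℝ V y v) x v
        - (fderiv ℝ V x v) ^ 2) * M x)
      + (2 * χ x * f x ^ 2 * fderiv ℝ χ x v + 2 * χ x ^ 2 * f x * fderiv ℝ f x v)
        * (fderiv ℝ V x v * M x)) ∧
    ∫ x, ((χ x ^ 2 * f x ^ 2) * ((fderiv ℝ (fun y => fderiv ℝ V y v) x v
        - (fderiv ℝ V x v) ^ 2) * M x)
      + (2 * χ x * f x ^ 2 * fderiv ℝ χ x v + 2 * χ x ^ 2 * f x * fderiv ℝ f x v)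
        * (fderiv ℝ V x v * M x)) = 0 := by
  obtain ⟨hfd, hf2, hfg⟩ := hf
  have hM' : M = fun x => Real.exp (-V x) := funext hM
  have hMC : ContDiff ℝ 2 M := by rw [hM']; exact hV.neg.exp
  have hWC : ContDiff ℝ 1 (fun y => fderiv ℝ V y v) :=
    (hV.fderiv_right (m := 1) (by norm_num)).clm_apply contDiff_const
  have hGC : ContDiff ℝ 1 (fun y => fderiv ℝ V y v * M y) := hWC.mul (hMC.of_le (by norm_num))
  have hχ' : Continuous (fun x => fderiv ℝ χ x v) :=
    (hχ.continuous_fderiv (by norm_num)).clm_apply continuous_const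
  have hχ0 := hχ.continuous
  have hf0 := hfd.continuous
  have hMder : ∀ x, HasFDerivAt M (M x • -fderiv ℝ V x) x := by
    intro x
    have h := ((hV.differentiable (by norm_num) x).hasFDerivAt.neg).exp
    rw [hM']; exact h
  have hG' : ∀ x, fderiv ℝ (fun y => fderiv ℝ V y v * M y) x v =
      (fderiv ℝ (fun y => fderiv ℝ V y v) x v - (fderiv ℝ V x v) ^ 2) * M x := by
    intro x
    have h := ((hWC.differentiable (by norm_num) x).hasFDerivAt.mul (hMder x)).fderiv
    have h2 : fderiv ℝ (fun y => fderiv ℝ V y v * M y) x = _ := h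
    rw [h2]; simp; ring
  have hu : ∀ x, HasFDerivAt (fun x => χ x ^ 2 * f x ^ 2)
      (χ x ^ 2 • ((2 * f x) • fderiv ℝ f x) + f x ^ 2 • ((2 * χ x) • fderiv ℝ χ x)) x := by
    intro x
    have h1 := (hχ.differentiable (by norm_num) x).hasFDerivAt.pow 2
    have h2 := (hfd x).hasFDerivAt.pow 2
    have h := h1.mul h2
    simp only [Nat.add_one_sub_one, pow_one, nsmul_eq_mul, Nat.cast_ofNat] at h
    exact h
  have hu' : ∀ x, fderiv ℝ (fun x => χ x ^ 2 * f x ^ 2) x v =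
      2 * χ x * f x ^ 2 * fderiv ℝ χ x v + 2 * χ x ^ 2 * f x * fderiv ℝ f x v := by
    intro x
    rw [(hu x).fderiv]; simp; ring
  have hW0 : Continuous (fun y => fderiv ℝ V y v) := hWC.continuous
  have hM0 : Continuous M := hMC.continuous
  have cs : ∀ g : EuclideanSpace ℝ (Fin n) → ℝ, HasCompactSupport (fun x => χ x * g x) :=
    fun g => hχc.mul_right
  -- integrability of the directional derivative against M
  have hfv : Integrable (fun x => fderiv ℝ f x v * M x) := by
    refine Integrable.mono' (g := fun x => ‖v‖ * (‖gradient f x‖ ^ 2 * M x + M x))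
      ((hfg.add hMint).const_mul _) ?_ ?_
    · exact ((measurable_fderiv_apply_const ℝ f v).mul hM0.measurable).aestronglyMeasurable
    · refine Eventually.of_forall fun x => ?_
      have hMx : 0 < M x := by rw [hM]; exact Real.exp_pos _
      have h1 : ‖fderiv ℝ f x v‖ ≤ ‖gradient f x‖ * ‖v‖ := by
        rw [← inner_gradient_left]; exact norm_inner_le_norm _ _
      rw [norm_mul, Real.norm_of_nonneg hMx.le]
      have h2 : ‖gradient f x‖ ≤ ‖gradient f x‖ ^ 2 + 1 := by
        nlinarith [sq_nonneg (‖gradient f x‖ - 1), sq_nonneg (‖gradient f x‖)]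
      calc ‖fderiv ℝ f x v‖ * M x ≤ (‖gradient f x‖ * ‖v‖) * M x := by gcongr
        _ ≤ ((‖gradient f x‖ ^ 2 + 1) * ‖v‖) * M x := by gcongr
        _ = _ := by ring
  have i1 : Integrable (fun x => fderiv ℝ (fun x => χ x ^ 2 * f x ^ 2) x v
      * (fderiv ℝ V x v * M x)) := by
    have a1 : Integrable (fun x => χ x * (2 * f x ^ 2 * fderiv ℝ χ x v
        * (fderiv ℝ V x v * M x))) :=
      Continuous.integrable_of_hasCompactSupport (by fun_prop) (cs _)
    have hb : Continuous (fun x => χ x * (2 * χ x * f x * fderiv ℝ V x v)) := by fun_prop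
    obtain ⟨K, hK⟩ := hb.bounded_above_of_compact_support (cs _)
    have a2 := hfv.bdd_mul (c := K) hb.aestronglyMeasurable (Eventually.of_forall hK)
    refine (a1.add a2).congr (Eventually.of_forall fun x => ?_)
    simp only [hu', Pi.add_apply]; ring
  have i2 : Integrable (fun x => (χ x ^ 2 * f x ^ 2)
      * fderiv ℝ (fun y => fderiv ℝ V y v * M y) x v) := by
    have hc : Continuous (fun x => fderiv ℝ (fun y => fderiv ℝ V y v * M y) x v) :=
      (hGC.continuous_fderiv (by norm_num)).clm_apply continuous_const
    have a1 : Integrable (fun x => χ x * ((χ x * f x ^ 2)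
      * fderiv ℝ (fun y => fderiv ℝ V y v * M y) x v)) :=
      Continuous.integrable_of_hasCompactSupport (by fun_prop) (cs _)
    exact a1.congr (Eventually.of_forall fun x => by ring)
  have i3 : Integrable (fun x => (χ x ^ 2 * f x ^ 2) * (fderiv ℝ V x v * M x)) := by
    have a1 : Integrable (fun x => χ x * ((χ x * f x ^ 2) * (fderiv ℝ V x v * M x))) :=
      Continuous.integrable_of_hasCompactSupport (by fun_prop) (cs _)
    exact a1.congr (Eventually.of_forall fun x => by ring)
  have key := integral_mul_fderiv_eq_neg_fderiv_mul_of_integrable i1 i2 i3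
    (fun x _ => (hu x).differentiableAt) (fun x _ => hGC.differentiable (by norm_num) x)
  have hs := integral_add i2 i1
  rw [key, neg_add_cancel] at hs
  have hi := i2.add i1
  simp only [hu', hG'] at hs hi
  exact ⟨hi, hs⟩

lemma ibp_full {n : ℕ} (V M f χ : EuclideanSpace ℝ (Fin n) → ℝ)
    (hV : ContDiff ℝ 2 V) (hM : ∀ x, M x = Real.exp (-V x)) (hMint : Integrable M)
    (hf : MemH1 M f) (hχ : ContDiff ℝ 1 χ) (hχc : HasCompactSupport χ) :
    Integrable (fun x => ((χ x ^ 2 * f x ^ 2) * (laplacian V x - ‖gradient V x‖ ^ 2)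
      + (2 * χ x * f x ^ 2 * fderiv ℝ χ x (gradient V x)
        + 2 * χ x ^ 2 * f x * fderiv ℝ f x (gradient V x))) * M x) ∧
    ∫ x, ((χ x ^ 2 * f x ^ 2) * (laplacian V x - ‖gradient V x‖ ^ 2)
      + (2 * χ x * f x ^ 2 * fderiv ℝ χ x (gradient V x)
        + 2 * χ x ^ 2 * f x * fderiv ℝ f x (gradient V x))) * M x = 0 := by
  have h := fun i : Fin n => ibp_dir V M f χ hV hM hMint hf hχ hχc (EuclideanSpace.single i 1)
  have hco : ∀ x (i : Fin n), fderiv ℝ V x (EuclideanSpace.single i 1) = gradient V x i := by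
    intro x i
    rw [← inner_gradient_left, EuclideanSpace.inner_single_right]; simp
  have hsum : ∀ (L : EuclideanSpace ℝ (Fin n) →L[ℝ] ℝ) (w : EuclideanSpace ℝ (Fin n)),
      L w = ∑ i, L (EuclideanSpace.single i 1) * w i := by
    intro L w
    conv_lhs => rw [← (EuclideanSpace.basisFun (Fin n) ℝ).sum_repr w]
    simp [mul_comm]
  have heq : ∀ x, ((χ x ^ 2 * f x ^ 2) * (laplacian V x - ‖gradient V x‖ ^ 2)
      + (2 * χ x * f x ^ 2 * fderiv ℝ χ x (gradient V x)
        + 2 * χ x ^ 2 * f x * fderiv ℝ f x (gradient V x))) * M x = ∑ i : Fin n,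
      ((χ x ^ 2 * f x ^ 2) * ((fderiv ℝ (fun y => fderiv ℝ V y (EuclideanSpace.single i 1)) x
        (EuclideanSpace.single i 1) - (fderiv ℝ V x (EuclideanSpace.single i 1)) ^ 2) * M x)
      + (2 * χ x * f x ^ 2 * fderiv ℝ χ x (EuclideanSpace.single i 1)
        + 2 * χ x ^ 2 * f x * fderiv ℝ f x (EuclideanSpace.single i 1))
        * (fderiv ℝ V x (EuclideanSpace.single i 1) * M x)) := by
    intro x
    rw [laplacian, EuclideanSpace.real_norm_sq_eq, hsum (fderiv ℝ χ x), hsum (fderiv ℝ f x)]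
    rw [← Finset.sum_sub_distrib, Finset.mul_sum, Finset.mul_sum, Finset.mul_sum,
      ← Finset.sum_add_distrib, ← Finset.sum_add_distrib, Finset.sum_mul]
    refine Finset.sum_congr rfl fun i _ => ?_
    rw [hco]; ring
  simp only [heq]
  refine ⟨integrable_finsetSum _ fun i _ => (h i).1, ?_⟩
  rw [integral_finsetSum _ fun i _ => (h i).1]
  exact Finset.sum_eq_zero fun i _ => (h i).2

lemma pointwise_alg (a F g s p q L C K : ℝ) (hC0 : 0 ≤ C) (h0 : 0 ≤ a) (h1 : a ≤ 1)
    (hp : |p| ≤ K * g) (hq : |q| ≤ s * g) (hL : L ≤ g ^ 2 / 2 + C) :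
    a ^ 2 * (F ^ 2 * g ^ 2) ≤ (4 * C + 32 * K ^ 2) * F ^ 2 + 32 * s ^ 2 -
      4 * ((a ^ 2 * F ^ 2) * (L - g ^ 2) + (2 * a * F ^ 2 * p + 2 * a ^ 2 * F * q)) := by
  have ha : a ^ 2 ≤ 1 := by nlinarith
  have e1 : (a ^ 2 * F ^ 2) * L ≤ (a ^ 2 * F ^ 2) * (g ^ 2 / 2 + C) := by gcongr
  have e2 : (a * F ^ 2) * p ≤ (a * F ^ 2) * (K * g) := by
    gcongr; exact (le_abs_self p).trans hp
  have e3 : F * q ≤ |F| * (s * g) := by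
    refine (le_abs_self _).trans ?_
    rw [abs_mul]; gcongr
  have e3' := mul_le_mul_of_nonneg_left e3 (sq_nonneg a)
  have e4 : a ^ 2 * (F ^ 2 * C) ≤ 1 * (F ^ 2 * C) := by gcongr
  have e5 : a ^ 2 * s ^ 2 ≤ 1 * s ^ 2 := by gcongr
  have e6 := mul_nonneg (sq_nonneg F) (sq_nonneg (a * g - 8 * K))
  have e7 := mul_nonneg (sq_nonneg a) (sq_nonneg (|F| * g - 8 * s))
  have e8 : |F| ^ 2 = F ^ 2 := sq_abs F
  have e9 : a ^ 2 * (|F| * g - 8 * s) ^ 2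
      = a ^ 2 * F ^ 2 * g ^ 2 - 16 * (a ^ 2 * (|F| * (s * g))) + 64 * (a ^ 2 * s ^ 2) := by
    rw [← e8]; ring
  rw [e9] at e7
  nlinarith

lemma cutoff_bound {n : ℕ} (V M f χ : EuclideanSpace ℝ (Fin n) → ℝ) (C K : ℝ) (hC0 : 0 ≤ C)
    (hV : ContDiff ℝ 2 V) (hM : ∀ x, M x = Real.exp (-V x)) (hMint : Integrable M)
    (hC : ∀ x, laplacian V x ≤ ‖gradient V x‖ ^ 2 / 2 + C)
    (hf : MemH1 M f) (hχ : ContDiff ℝ 1 χ) (hχc : HasCompactSupport χ)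
    (h0 : ∀ x, 0 ≤ χ x) (h1 : ∀ x, χ x ≤ 1) (hK : ∀ x, ‖fderiv ℝ χ x‖ ≤ K)
    (hint : Integrable (fun x => χ x ^ 2 * (f x ^ 2 * ‖gradient V x‖ ^ 2 * M x))) :
    (∫ x, χ x ^ 2 * (f x ^ 2 * ‖gradient V x‖ ^ 2 * M x)) ≤
      (4 * C + 32 * K ^ 2) * (∫ x, f x ^ 2 * M x) + 32 * ∫ x, ‖gradient f x‖ ^ 2 * M x := by
  obtain ⟨hi, hz⟩ := ibp_full V M f χ hV hM hMint hf hχ hχc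
  have hq : ∀ x, χ x ^ 2 * (f x ^ 2 * ‖gradient V x‖ ^ 2 * M x) ≤
      ((4 * C + 32 * K ^ 2) * (f x ^ 2 * M x) + 32 * (‖gradient f x‖ ^ 2 * M x)) -
      4 * (((χ x ^ 2 * f x ^ 2) * (laplacian V x - ‖gradient V x‖ ^ 2)
      + (2 * χ x * f x ^ 2 * fderiv ℝ χ x (gradient V x)
        + 2 * χ x ^ 2 * f x * fderiv ℝ f x (gradient V x))) * M x) := by
    intro x
    have hMx : 0 < M x := by rw [hM]; exact Real.exp_pos _
    have hp : |fderiv ℝ χ x (gradient V x)| ≤ K * ‖gradient V x‖ :=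
      ((fderiv ℝ χ x).le_opNorm _).trans (by gcongr; exact hK x)
    have hq : |fderiv ℝ f x (gradient V x)| ≤ ‖gradient f x‖ * ‖gradient V x‖ := by
      rw [← inner_gradient_left]; exact abs_real_inner_le_norm _ _
    have := pointwise_alg (χ x) (f x) ‖gradient V x‖ ‖gradient f x‖ _ _ (laplacian V x) C K hC0
      (h0 x) (h1 x) hp hq (hC x)
    have := mul_le_mul_of_nonneg_right this hMx.le
    linarith
  have r1 : Integrable (fun x => (4 * C + 32 * K ^ 2) * (f x ^ 2 * M x)) := hf.2.1.const_mul _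
  have r2 : Integrable (fun x => 32 * (‖gradient f x‖ ^ 2 * M x)) := hf.2.2.const_mul _
  have r12 : Integrable (fun x => (4 * C + 32 * K ^ 2) * (f x ^ 2 * M x)
    + 32 * (‖gradient f x‖ ^ 2 * M x)) := r1.add r2
  have hm := integral_mono hint (r12.sub (hi.const_mul 4)) hq
  refine hm.trans (le_of_eq ?_)
  have e := integral_sub r12 (hi.const_mul 4)
  simp only [Pi.sub_apply] at e ⊢
  rw [e, integral_add r1 r2, integral_const_mul, integral_const_mul, integral_const_mul, hz]
  ring

lemma exists_cutoffs (n : ℕ) : ∃ K : ℝ, ∃ χ : ℕ → EuclideanSpace ℝ (Fin n) → ℝ,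
    (∀ k, ContDiff ℝ 1 (χ k)) ∧ (∀ k, HasCompactSupport (χ k)) ∧ (∀ k x, 0 ≤ χ k x) ∧
    (∀ k x, χ k x ≤ 1) ∧ (∀ k x, ‖fderiv ℝ (χ k) x‖ ≤ K) ∧
    (∀ x, ∀ᶠ k in atTop, χ k x = 1) := by
  let φ : ContDiffBump (0 : EuclideanSpace ℝ (Fin n)) := ⟨1, 2, by norm_num, by norm_num⟩
  have hφ : ContDiff ℝ 1 φ := φ.contDiff (n := 1)
  obtain ⟨K, hK⟩ := (hφ.continuous_fderiv (by norm_num)).bounded_above_of_compact_support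
    (φ.hasCompactSupport.fderiv ℝ)
  have hlin : ∀ c : ℝ, ContDiff ℝ 1 (fun x : EuclideanSpace ℝ (Fin n) => c • x) := fun c =>
    contDiff_id.const_smul c
  have hpos : ∀ k : ℕ, (0 : ℝ) < ((k : ℝ) + 1)⁻¹ := fun k => by positivity
  refine ⟨K, fun k x => φ (((k : ℝ) + 1)⁻¹ • x), fun k => hφ.comp (hlin _), fun k => ?_,
    fun k x => φ.nonneg, fun k x => φ.le_one, fun k x => ?_, fun x => ?_⟩
  · exact φ.hasCompactSupport.comp_smul (hpos k).ne'
  · have h1 : HasFDerivAt (fun x : EuclideanSpace ℝ (Fin n) => ((k : ℝ) + 1)⁻¹ • x)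
        (((k : ℝ) + 1)⁻¹ • ContinuousLinearMap.id ℝ _) x :=
      (hasFDerivAt_id (𝕜 := ℝ) x).const_smul (((k : ℝ) + 1)⁻¹)
    have h2 := ((hφ.differentiable (by norm_num)) (((k : ℝ) + 1)⁻¹ • x)).hasFDerivAt.comp x h1
    have h3 : fderiv ℝ (fun x => φ (((k : ℝ) + 1)⁻¹ • x)) x = _ := h2.fderiv
    rw [h3, ContinuousLinearMap.comp_smul, ContinuousLinearMap.comp_id, norm_smul,
      Real.norm_of_nonneg (hpos k).le]
    have h4 : ((k : ℝ) + 1)⁻¹ ≤ 1 := inv_le_one_of_one_le₀ (by linarith [(Nat.cast_nonneg k : (0:ℝ) ≤ k)])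
    calc _ ≤ 1 * ‖fderiv ℝ φ (((k : ℝ) + 1)⁻¹ • x)‖ := by gcongr
      _ ≤ K := by rw [one_mul]; exact hK _
  · filter_upwards [eventually_ge_atTop ⌈‖x‖⌉₊] with k hk
    apply φ.one_of_mem_closedBall
    rw [mem_closedBall_zero_iff, norm_smul, Real.norm_of_nonneg (hpos k).le]
    change _ ≤ (1 : ℝ)
    have : ‖x‖ ≤ k := Nat.ceil_le.mp hk
    rw [inv_mul_le_iff₀ (by positivity)]
    linarith

lemma laplacian_bound {n : ℕ} (V : EuclideanSpace ℝ (Fin n) → ℝ) (hV : ContDiff ℝ 2 V)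
    (hconf : ∃ ε > (0:ℝ), Tendsto
      (fun x => (1 - ε) * ‖gradient V x‖ ^ 2 / 2 - laplacian V x)
      (cocompact (EuclideanSpace ℝ (Fin n))) atTop) :
    ∃ C : ℝ, 0 ≤ C ∧ ∀ x, laplacian V x ≤ ‖gradient V x‖ ^ 2 / 2 + C := by
  obtain ⟨ε, hε, ht⟩ := hconf
  have hgn : ∀ x, ‖gradient V x‖ = ‖fderiv ℝ V x‖ := fun x => by
    rw [← toDual_gradient, LinearIsometryEquiv.norm_map]
  have hgc : Continuous (fun x => ‖gradient V x‖) := by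
    simp only [hgn]; exact (hV.continuous_fderiv (by norm_num)).norm
  have hlc : Continuous (fun x => laplacian V x) := by
    unfold laplacian
    refine continuous_finsetSum _ fun i _ => ?_
    have hWC : ContDiff ℝ 1 (fun y => fderiv ℝ V y (EuclideanSpace.single i 1)) :=
      (hV.fderiv_right (m := 1) (by norm_num)).clm_apply contDiff_const
    exact (hWC.continuous_fderiv (by norm_num)).clm_apply continuous_const
  obtain ⟨s, hs, hsub⟩ := mem_cocompact.mp (ht.eventually (eventually_ge_atTop 0))
  obtain ⟨C, hC⟩ := hs.bddAbove_image hlc.continuousOn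
  refine ⟨max C 0, le_max_right _ _, fun x => ?_⟩
  by_cases hx : x ∈ s
  · have := hC (mem_image_of_mem _ hx)
    have h2 := le_max_left C 0
    nlinarith [sq_nonneg ‖gradient V x‖]
  · have h3 : 0 ≤ (1 - ε) * ‖gradient V x‖ ^ 2 / 2 - laplacian V x := hsub hx
    have h2 := le_max_right C 0
    nlinarith [mul_nonneg hε.le (sq_nonneg ‖gradient V x‖)]

/-- Improved Poincaré inequality (Proposition 1 of the paper): under the strengthened
condition on `V`, the Dirichlet energy controls the `L²(M)` norm weighted by
`1 + |∇ ln M|²` for zero-average functions. -/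
theorem improved_poincare {n : ℕ} (hn : 1 ≤ n)
    (V M : EuclideanSpace ℝ (Fin n) → ℝ)
    (hV : ContDiff ℝ 2 V)
    (hM : ∀ x, M x = Real.exp (-V x))
    (hMint : Integrable M)
    (hpoinc : ∃ lam > (0:ℝ), ∀ f : EuclideanSpace ℝ (Fin n) → ℝ, MemH1 M f →
      (∫ x, ‖gradient f x‖ ^ 2 * M x)
        ≥ lam * ∫ y, |f y - ∫ x, f x * M x| ^ 2 * M y)
    (hconf : ∃ ε > (0:ℝ), Tendsto
      (fun x => (1 - ε) * ‖gradient V x‖ ^ 2 / 2 - laplacian V x)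
      (cocompact (EuclideanSpace ℝ (Fin n))) atTop) :
    ∃ lam' > (0:ℝ), ∀ f : EuclideanSpace ℝ (Fin n) → ℝ, MemH1 M f →
      (∫ x, f x * M x) = 0 →
      (∫ x, ‖gradient f x‖ ^ 2 * M x)
        ≥ lam' * ∫ x, |f x| ^ 2
            * (1 + ‖gradient (fun y => Real.log (M y)) x‖ ^ 2) * M x := by
  obtain ⟨lam, hlam, hP⟩ := hpoinc
  obtain ⟨C, hC0, hC⟩ := laplacian_bound V hV hconf
  obtain ⟨K, χ, hχ, hχc, h0, h1, hK, hχ1⟩ := exists_cutoffs n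
  have hlog : ∀ x, ‖gradient (fun y => Real.log (M y)) x‖ = ‖gradient V x‖ := by
    intro x
    have : (fun y => Real.log (M y)) = fun y => -V y := by
      funext y; rw [hM, Real.log_exp]
    rw [this, gradient, gradient, LinearIsometryEquiv.norm_map, LinearIsometryEquiv.norm_map,
      fderiv_fun_neg, norm_neg]
  simp only [hlog, sq_abs] at *
  set B : ℝ := 1 + 4 * C + 32 * K ^ 2 with hB
  have hBpos : 0 < B := by positivity
  have hD : 0 < B / lam + 32 := by positivity
  refine ⟨(B / lam + 32)⁻¹, by positivity, fun f hf hmean => ?_⟩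
  have hMpos : ∀ x, 0 < M x := fun x => by rw [hM]; exact Real.exp_pos _
  have hE0 : 0 ≤ ∫ x, ‖gradient f x‖ ^ 2 * M x :=
    integral_nonneg fun x => mul_nonneg (sq_nonneg _) (hMpos x).le
  by_cases hI : Integrable (fun x => f x ^ 2 * (1 + ‖gradient V x‖ ^ 2) * M x)
  swap
  · rw [integral_undef hI, mul_zero]; exact hE0
  have hpf := hP f hf
  simp only [hmean, sub_zero] at hpf
  have hI2 : Integrable (fun x => f x ^ 2 * ‖gradient V x‖ ^ 2 * M x) :=
    (hI.sub hf.2.1).congr (Eventually.of_forall fun x => by simp only [Pi.sub_apply]; ring)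
  have hsplit : ∫ x, f x ^ 2 * (1 + ‖gradient V x‖ ^ 2) * M x =
      (∫ x, f x ^ 2 * M x) + ∫ x, f x ^ 2 * ‖gradient V x‖ ^ 2 * M x := by
    rw [← integral_add hf.2.1 hI2]
    congr 1; funext x; ring
  have hmeas : ∀ k, AEStronglyMeasurable
      (fun x => χ k x ^ 2 * (f x ^ 2 * ‖gradient V x‖ ^ 2 * M x)) volume := fun k =>
    ((hχ k).continuous.pow 2).aestronglyMeasurable.mul hI2.aestronglyMeasurable
  have hbd : ∀ k x, ‖χ k x ^ 2 * (f x ^ 2 * ‖gradient V x‖ ^ 2 * M x)‖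
      ≤ f x ^ 2 * ‖gradient V x‖ ^ 2 * M x := by
    intro k x
    have hn0 : 0 ≤ f x ^ 2 * ‖gradient V x‖ ^ 2 * M x :=
      mul_nonneg (by positivity) (hMpos x).le
    rw [Real.norm_of_nonneg (mul_nonneg (sq_nonneg _) hn0)]
    exact mul_le_of_le_one_left hn0 (pow_le_one₀ (h0 k x) (h1 k x))
  have hlim := tendsto_integral_of_dominated_convergence
    (F := fun k x => χ k x ^ 2 * (f x ^ 2 * ‖gradient V x‖ ^ 2 * M x))
    (f := fun x => f x ^ 2 * ‖gradient V x‖ ^ 2 * M x) _ hmeas hI2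
    (fun k => Eventually.of_forall (hbd k)) (Eventually.of_forall fun x => by
      refine tendsto_const_nhds.congr' ?_
      filter_upwards [hχ1 x] with k hk
      rw [hk]; ring)
  have hle := le_of_tendsto' hlim fun k => cutoff_bound V M f (χ k) C K hC0 hV hM hMint hC hf
    (hχ k) (hχc k) (h0 k) (h1 k) (hK k)
    (hI2.mono' (hmeas k) (Eventually.of_forall (hbd k)))
  rw [ge_iff_le, inv_mul_le_iff₀ hD, hsplit]
  have h5 : ∫ x, f x ^ 2 * M x ≤ (∫ x, ‖gradient f x‖ ^ 2 * M x) / lam := by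
    rw [le_div_iff₀ hlam]; linarith
  have h6 := mul_le_mul_of_nonneg_left h5 hBpos.le
  have h7 : (B / lam + 32) * (∫ x, ‖gradient f x‖ ^ 2 * M x) =
    B * ((∫ x, ‖gradient f x‖ ^ 2 * M x) / lam) + 32 * ∫ x, ‖gradient f x‖ ^ 2 * M x := by ring
  rw [h7]
  rw [hB] at h6 ⊢
  linarith
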